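/- arXiv:2211.01782 — 2 statements merged into one kernel-verified Lean document; each statement's English description precedes it below -/
import Mathlib

section
/- Let Q be a quantale, C a Q-category on X all of whose homs are non-zero (C(x,y) ≠ 0 for all x, y ∈ X), φ a control function on Q, and f : X → X a φ-contraction. If u and u' are both fixpoints of f, then u ≅ u', i.e. 1 ≤ C(u, u') and 1 ≤ C(u', u). -/
/-- Composing with arrows `x ⟶ x'` and `y' ⟶ y` does not decrease homs. -/
theorem hom_le_hom_of_one_le
    {Q : Type*} [Monoid Q] [CompleteLattice Q] [IsQuantale Q]
    {X : Type*} (C : X → X → Q)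
    (hC_comp : ∀ x y z, C x y * C y z ≤ C x z)
    {x x' y y' : X} (hx : 1 ≤ C x x') (hy : 1 ≤ C y' y) :
    C x' y' ≤ C x y :=
  calc
    C x' y' = 1 * C x' y' * 1 := by rw [one_mul, mul_one]
    _ ≤ C x x' * C x' y' * C y' y := by gcongr
    _ ≤ C x y' * C y' y := by gcongr; exact hC_comp x x' y'
    _ ≤ C x y := hC_comp x y' y

/-- A non-zero hom from a point `u` with `u ≤ f u` to a point `v` with `f v ≤ v` is at least `1`
when `f` is a `φ`-contraction. -/
theorem one_le_hom_of_fixpoints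
    {Q : Type*} [Monoid Q] [CompleteLattice Q] [IsQuantale Q]
    {X : Type*} (C : X → X → Q)
    (hC_comp : ∀ x y z, C x y * C y z ≤ C x z)
    (φ : Q → Q)
    (hφ_le : ∀ t, t ≤ φ t)
    (hφ_fix : ∀ t, φ t = t → t = ⊥ ∨ 1 ≤ t)
    (f : X → X)
    (hf : ∀ x y, φ (C x y) ≤ C (f x) (f y))
    {u v : X} (h_nonzero : C u v ≠ ⊥)
    (hu : 1 ≤ C u (f u)) (hv : 1 ≤ C (f v) v) :
    1 ≤ C u v :=
  (hφ_fix _ (((hf u v).trans (hom_le_hom_of_one_le C hC_comp hu hv)).antisymm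
    (hφ_le _))).resolve_left h_nonzero


/-- if all homs of the `Q`-category are non-zero, any two
fixpoints of a `φ`-contraction are isomorphic. -/
theorem fixpoints_isomorphic_of_homs_nonzero
    {Q : Type*} [Monoid Q] [CompleteLattice Q] [IsQuantale Q]
    {X : Type*} (C : X → X → Q)
    (hC_id : ∀ x, 1 ≤ C x x)
    (hC_comp : ∀ x y z, C x y * C y z ≤ C x z)
    (hC_nonzero : ∀ x y, C x y ≠ ⊥)
    (φ : Q → Q)
    (hφ_le : ∀ t, t ≤ φ t)
    (hφ_fix : ∀ t, φ t = t → t = ⊥ ∨ 1 ≤ t)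
    (f : X → X)
    (hf : ∀ x y, φ (C x y) ≤ C (f x) (f y))
    (u u' : X)
    (hu : 1 ≤ C (f u) u ∧ 1 ≤ C u (f u))
    (hu' : 1 ≤ C (f u') u' ∧ 1 ≤ C u' (f u')) :
    1 ≤ C u u' ∧ 1 ≤ C u' u :=
  ⟨one_le_hom_of_fixpoints C hC_comp φ hφ_le hφ_fix f hf (hC_nonzero u u') hu.2 hu'.1,
    one_le_hom_of_fixpoints C hC_comp φ hφ_le hφ_fix f hf (hC_nonzero u' u) hu'.2 hu.1⟩
end

section
/- Weakened fixpoint theorem: Let Q be a quantale whose underlying complete lattice is continuous at 1, i.e. 1 = sup {u ∈ Q | u ≪ 1}. Let C be a Cauchy-complete Q-category on X, φ a sequentially lower-semicontinuous control function on Q, and f : X → X a φ-contraction. If there exists x ∈ X with C(x, f x) ≠ 0 and C(f x, x) ≠ 0, then there exists u ∈ X with 1 ≤ C(f u, u) and 1 ≤ C(u, f u). -/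
/-- `a` is way below `b` in a complete lattice. -/
def WayBelow {L : Type*} [CompleteLattice L] (a b : L) : Prop :=
  ∀ D : Set L, D.Nonempty → DirectedOn (· ≤ ·) D → b ≤ sSup D → ∃ d ∈ D, a ≤ d

/-- The order-theoretic limit inferior of a sequence in a complete lattice. -/
def seqLiminf {L : Type*} [CompleteLattice L] (t : ℕ → L) : L :=
  ⨆ N, ⨅ n ≥ N, t n

section Lattice

variable {L : Type*} [CompleteLattice L]

theorem le_seqLiminf {t : ℕ → L} {a : L} (N : ℕ) (h : ∀ n ≥ N, a ≤ t n) : a ≤ seqLiminf t :=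
  le_iSup_of_le N (le_iInf₂ h)

theorem seqLiminf_le_iff {t : ℕ → L} {a : L} :
    seqLiminf t ≤ a ↔ ∀ N, ⨅ n ≥ N, t n ≤ a :=
  iSup_le_iff

theorem WayBelow.le {a b : L} (h : WayBelow a b) : a ≤ b := by
  obtain ⟨d, rfl, hd⟩ := h {b} (Set.singleton_nonempty b) (directedOn_singleton b)
    sSup_singleton.ge
  exact hd

theorem WayBelow.eventually_le_of_le_seqLiminf {a b : L} (h : WayBelow a b) {t : ℕ → L}
    (ht : b ≤ seqLiminf t) : ∃ N, ∀ n ≥ N, a ≤ t n := by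
  have hmono : Monotone fun N => ⨅ n ≥ N, t n := fun i j hij =>
    le_iInf₂ fun n hn => iInf₂_le n (hij.trans hn)
  obtain ⟨_, ⟨N, rfl⟩, hN⟩ := h (Set.range fun N => ⨅ n ≥ N, t n) (Set.range_nonempty _)
    hmono.directed_le.directedOn_range ht
  exact ⟨N, fun n hn => hN.trans (iInf₂_le n hn)⟩

end Lattice

section Quantale

variable {Q : Type*} [Monoid Q] [CompleteLattice Q]

theorem one_le_of_forall_wayBelow (hQ1 : (1 : Q) = sSup {u | WayBelow u 1}) {a : Q}
    (h : ∀ u, WayBelow u 1 → u ≤ a) : 1 ≤ a :=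
  hQ1.le.trans (sSup_le h)

/-- Iterating a control function from a nonzero value reaches the unit in the limit. -/
theorem one_le_iSup_of_control_le {φ : Q → Q} (hφ_le : ∀ t, t ≤ φ t)
    (hφ_fix : ∀ t, φ t = t → t = ⊥ ∨ 1 ≤ t)
    (hφ_lsc : ∀ t : ℕ → Q, φ (seqLiminf t) ≤ seqLiminf fun n => φ (t n))
    {t : ℕ → Q} (ht : ∀ n, φ (t n) ≤ t (n + 1)) (h0 : t 0 ≠ ⊥) : 1 ≤ ⨆ n, t n := by
  have hmono : Monotone t := monotone_nat_of_le_succ fun n => (hφ_le _).trans (ht n)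
  have hsup : ⨆ n, t n = seqLiminf t := by
    refine le_antisymm (iSup_le fun n => le_seqLiminf n fun m hm => hmono hm) ?_
    exact seqLiminf_le_iff.2 fun N => (iInf₂_le N le_rfl).trans (le_iSup t N)
  have hfix : φ (seqLiminf t) ≤ seqLiminf t := by
    refine (hφ_lsc t).trans (seqLiminf_le_iff.2 fun N => ?_)
    rw [← hsup]
    exact (iInf₂_le N le_rfl).trans ((ht N).trans (le_iSup t (N + 1)))
  rw [hsup]
  refine (hφ_fix _ (hfix.antisymm (hφ_le _))).resolve_left fun hbot => h0 ?_
  exact le_bot_iff.1 ((le_iSup t 0).trans (hsup.trans hbot).le)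

variable [IsQuantale Q]

/-- Multiplying by sequences whose suprema are above the unit does not decrease
the limit inferior. -/
theorem seqLiminf_le_of_mul_mul_le {l r p q : ℕ → Q} (hl : Monotone l) (hr : Monotone r)
    (hl1 : 1 ≤ ⨆ n, l n) (hr1 : 1 ≤ ⨆ n, r n) (h : ∀ n, l n * p n * r n ≤ q n) :
    seqLiminf p ≤ seqLiminf q := by
  calc seqLiminf p = 1 * seqLiminf p * 1 := by simp
    _ ≤ (⨆ n, l n) * (⨆ N, ⨅ n ≥ N, p n) * ⨆ n, r n :=
      mul_le_mul' (mul_le_mul' hl1 le_rfl) hr1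
    _ ≤ seqLiminf q := by
      simp only [Quantale.mul_iSup_distrib, Quantale.iSup_mul_distrib, iSup_le_iff]
      intro i j k
      refine le_seqLiminf (max (max i j) k) fun n hn => le_trans ?_ (h n)
      simp only [ge_iff_le, max_le_iff] at hn
      refine mul_le_mul' (mul_le_mul' ?_ (iInf₂_le n ?_)) ?_
      · exact hl (by omega)
      · omega
      · exact hr (by omega)

/-- The Boyd–Wong argument: the values `D n k`, thought of as distances between the `n`-th and
the `(n + k)`-th iterate, are eventually above any element way below the unit. -/
theorem eventually_le_of_control {φ : Q → Q} (hφ_le : ∀ t, t ≤ φ t)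
    (hφ_fix : ∀ t, φ t = t → t = ⊥ ∨ 1 ≤ t)
    (hφ_lsc : ∀ t : ℕ → Q, φ (seqLiminf t) ≤ seqLiminf fun n => φ (t n))
    {D : ℕ → ℕ → Q} {l r l' r' : ℕ → Q}
    (hl : Monotone l) (hr : Monotone r) (hl' : Monotone l') (hr' : Monotone r')
    (hl1 : 1 ≤ ⨆ n, l n) (hr1 : 1 ≤ ⨆ n, r n) (hl1' : 1 ≤ ⨆ n, l' n) (hr1' : 1 ≤ ⨆ n, r' n)
    (h0 : ∀ n, 1 ≤ D n 0) (hstep : ∀ n k, l n * D n k * r n ≤ D n (k + 1))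
    (hcontr : ∀ n k, l' n * φ (D n k) * r' n ≤ D n k)
    {u : Q} (hu : WayBelow u 1) : ∃ N, ∀ n ≥ N, ∀ k, u ≤ D n k := by
  by_contra! hcon
  have hpair : ∀ N, ∃ n ≥ N, ∃ k, u ≤ D n k ∧ ¬ u ≤ D n (k + 1) := by
    intro N
    obtain ⟨n, hn, hk⟩ := hcon N
    refine ⟨n, hn, ?_⟩
    by_contra! hall
    obtain ⟨k, hk⟩ := hk
    exact hk (Nat.rec (hu.le.trans (h0 n)) (fun k ih => hall k ih) k)
  choose n hn k hk hk' using hpair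
  set a : ℕ → Q := fun N => D (n N) (k N + 1) with ha
  have hua : u ≤ seqLiminf a :=
    (le_seqLiminf 0 fun _ _ => le_rfl).trans <|
      seqLiminf_le_of_mul_mul_le (p := fun _ => u) hl hr hl1 hr1 fun N =>
        (mul_le_mul' (mul_le_mul' (hl (hn N)) (hk N)) (hr (hn N))).trans (hstep _ _)
  have hfix : φ (seqLiminf a) ≤ seqLiminf a :=
    (hφ_lsc a).trans <| seqLiminf_le_of_mul_mul_le hl' hr' hl1' hr1' fun N =>
      (mul_le_mul' (mul_le_mul' (hl' (hn N)) le_rfl) (hr' (hn N))).trans (hcontr _ _)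
  rcases hφ_fix _ (hfix.antisymm (hφ_le _)) with hbot | hone
  · exact hk' 0 (le_bot_iff.1 (hua.trans hbot.le) ▸ bot_le)
  · obtain ⟨N, hN⟩ := hu.eventually_le_of_le_seqLiminf hone
    exact hk' N (hN N le_rfl)

/-- In a Cauchy-complete `Q`-category, every Cauchy sequence `s` has a limit, stated through
the presheaves represented by it. -/
theorem exists_limit_of_cauchy (hQ1 : (1 : Q) = sSup {u | WayBelow u 1})
    {X : Type*} {C : X → X → Q} (hC_comp : ∀ x y z, C x y * C y z ≤ C x z)
    (hcc : ∀ φ ψ : X → Q,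
      (∀ y y', C y' y * φ y ≤ φ y') →
      (∀ y y', ψ y * C y y' ≤ ψ y') →
      (1 ≤ ⨆ y, ψ y * φ y) →
      (∀ y y', φ y * ψ y' ≤ C y y') →
      ∃ u, (∀ y, φ y = C y u) ∧ (∀ y, ψ y = C u y))
    {s : ℕ → X}
    (hs : ∀ v, WayBelow v 1 → ∃ N, ∀ m ≥ N, ∀ n ≥ N, v ≤ C (s m) (s n)) :
    ∃ u, (∀ y, seqLiminf (fun n => C y (s n)) = C y u) ∧
      ∀ y, seqLiminf (fun n => C (s n) y) = C u y := by
  refine hcc _ _ ?_ ?_ ?_ ?_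
  · intro y y'
    simp only [seqLiminf, Quantale.mul_iSup_distrib]
    exact iSup_le fun N => le_seqLiminf N fun n hn =>
      (mul_le_mul' le_rfl (iInf₂_le n hn)).trans (hC_comp _ _ _)
  · intro y y'
    simp only [seqLiminf, Quantale.iSup_mul_distrib]
    exact iSup_le fun N => le_seqLiminf N fun n hn =>
      (mul_le_mul' (iInf₂_le n hn) le_rfl).trans (hC_comp _ _ _)
  · have key : ∀ v w, WayBelow v (1 : Q) → WayBelow w 1 →
        v * w ≤ ⨆ y, seqLiminf (fun n => C (s n) y) * seqLiminf (fun n => C y (s n)) := by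
      intro v w hv hw
      obtain ⟨N, hN⟩ := hs v hv
      obtain ⟨M, hM⟩ := hs w hw
      refine le_iSup_of_le (s (max N M)) (mul_le_mul' ?_ ?_)
      · exact le_seqLiminf N fun n hn => hN n hn _ (le_max_left _ _)
      · exact le_seqLiminf M fun n hn => hM _ (le_max_right _ _) n hn
    calc (1 : Q) = 1 * 1 := (one_mul 1).symm
      _ ≤ sSup {u | WayBelow u 1} * sSup {u | WayBelow u 1} := mul_le_mul' hQ1.le hQ1.le
      _ ≤ _ := by
        rw [mul_sSup_distrib]
        refine iSup₂_le fun w hw => ?_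
        rw [sSup_mul_distrib]
        exact iSup₂_le fun v hv => key v w hv hw
  · intro y y'
    simp only [seqLiminf, Quantale.iSup_mul_distrib, Quantale.mul_iSup_distrib]
    exact iSup₂_le fun i j =>
      (mul_le_mul' (iInf₂_le (max i j) (by omega)) (iInf₂_le (max i j) (by omega))).trans
        (hC_comp _ _ _)

end Quantale


/-- Weakened fixpoint theorem: it suffices that the underlying
lattice of the quantale is continuous at `1`. -/
theorem fixpoint_theorem_continuous_at_one
    {Q : Type*} [Monoid Q] [CompleteLattice Q] [IsQuantale Q]
    (hQ1 : (1 : Q) = sSup {u | WayBelow u 1})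
    {X : Type*} (C : X → X → Q)
    (hC_id : ∀ x, 1 ≤ C x x)
    (hC_comp : ∀ x y z, C x y * C y z ≤ C x z)
    (hcc : ∀ φ ψ : X → Q,
      (∀ y y', C y' y * φ y ≤ φ y') →
      (∀ y y', ψ y * C y y' ≤ ψ y') →
      (1 ≤ ⨆ y, ψ y * φ y) →
      (∀ y y', φ y * ψ y' ≤ C y y') →
      ∃ u, (∀ y, φ y = C y u) ∧ (∀ y, ψ y = C u y))
    (φ : Q → Q)
    (hφ_le : ∀ t, t ≤ φ t)
    (hφ_fix : ∀ t, φ t = t → t = ⊥ ∨ 1 ≤ t)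
    (hφ_lsc : ∀ t : ℕ → Q, φ (⨆ N, ⨅ n ≥ N, t n) ≤ ⨆ N, ⨅ n ≥ N, φ (t n))
    (f : X → X)
    (hf : ∀ x y, φ (C x y) ≤ C (f x) (f y))
    (x : X) (hx₁ : C x (f x) ≠ ⊥) (hx₂ : C (f x) x ≠ ⊥) :
    ∃ u : X, 1 ≤ C (f u) u ∧ 1 ≤ C u (f u) := by
  have hφ_lsc' : ∀ t : ℕ → Q, φ (seqLiminf t) ≤ seqLiminf fun n => φ (t n) := hφ_lsc
  have hf' : ∀ a b, C a b ≤ C (f a) (f b) := fun a b => (hφ_le _).trans (hf a b)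
  set s : ℕ → X := fun n => f^[n] x with hs
  have hs_succ : ∀ n, s (n + 1) = f (s n) := fun n => Function.iterate_succ_apply' f n x
  set t : ℕ → Q := fun n => C (s n) (s (n + 1)) with ht
  set t' : ℕ → Q := fun n => C (s (n + 1)) (s n) with ht'
  have htφ : ∀ n, φ (t n) ≤ t (n + 1) := fun n => by
    simpa only [ht, hs_succ] using hf (s n) (s (n + 1))
  have htφ' : ∀ n, φ (t' n) ≤ t' (n + 1) := fun n => by
    simpa only [ht', hs_succ] using hf (s (n + 1)) (s n)
  have hmono : Monotone t := monotone_nat_of_le_succ fun n => (hφ_le _).trans (htφ n)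
  have hmono' : Monotone t' := monotone_nat_of_le_succ fun n => (hφ_le _).trans (htφ' n)
  have ht1 : 1 ≤ ⨆ n, t n := one_le_iSup_of_control_le hφ_le hφ_fix hφ_lsc' htφ hx₁
  have ht1' : 1 ≤ ⨆ n, t' n := one_le_iSup_of_control_le hφ_le hφ_fix hφ_lsc' htφ' hx₂
  have hone : Monotone fun _ : ℕ => (1 : Q) := monotone_const
  have hone1 : (1 : Q) ≤ ⨆ _ : ℕ, (1 : Q) := le_iSup (fun _ : ℕ => (1 : Q)) 0
  have hcontr : ∀ m n i, i ≤ m → i ≤ n → t i * φ (C (s m) (s n)) * t' i ≤ C (s m) (s n) := by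
    intro m n i him hin
    have hφC : φ (C (s m) (s n)) ≤ C (s (m + 1)) (s (n + 1)) := by
      simpa only [hs_succ] using hf (s m) (s n)
    calc t i * φ (C (s m) (s n)) * t' i
        ≤ t m * C (s (m + 1)) (s (n + 1)) * t' n :=
          mul_le_mul' (mul_le_mul' (hmono him) hφC) (hmono' hin)
      _ ≤ C (s m) (s (n + 1)) * t' n := mul_le_mul' (hC_comp _ _ _) le_rfl
      _ ≤ C (s m) (s n) := hC_comp _ _ _
  have hcauchy : ∀ v : Q, WayBelow v 1 → ∃ N, ∀ m ≥ N, ∀ n ≥ N, v ≤ C (s m) (s n) := by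
    intro v hv
    obtain ⟨N, hN⟩ := eventually_le_of_control hφ_le hφ_fix hφ_lsc'
      (D := fun n k => C (s n) (s (n + k))) hone hmono hmono hmono' hone1 ht1 ht1 ht1'
      (fun n => hC_id _)
      (fun n k => by
        rw [one_mul]
        exact (mul_le_mul' le_rfl (hmono (Nat.le_add_right n k))).trans (hC_comp _ _ _))
      (fun n k => hcontr _ _ n le_rfl (Nat.le_add_right n k)) hv
    obtain ⟨M, hM⟩ := eventually_le_of_control hφ_le hφ_fix hφ_lsc'
      (D := fun n k => C (s (n + k)) (s n)) hmono' hone hmono hmono' ht1' hone1 ht1 ht1'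
      (fun n => hC_id _)
      (fun n k => by
        rw [mul_one]
        exact (mul_le_mul' (hmono' (Nat.le_add_right n k)) le_rfl).trans (hC_comp _ _ _))
      (fun n k => hcontr _ _ n (Nat.le_add_right n k) le_rfl) hv
    refine ⟨max N M, fun m hm n hn => ?_⟩
    rcases le_total m n with hmn | hmn
    · obtain ⟨k, rfl⟩ := Nat.exists_eq_add_of_le hmn
      exact hN m (le_of_max_le_left hm) k
    · obtain ⟨k, rfl⟩ := Nat.exists_eq_add_of_le hmn
      exact hM n (le_of_max_le_right hn) k
  obtain ⟨u, hu, hu'⟩ := exists_limit_of_cauchy hQ1 hC_comp hcc hcauchy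
  refine ⟨u, one_le_of_forall_wayBelow hQ1 fun v hv => ?_,
    one_le_of_forall_wayBelow hQ1 fun v hv => ?_⟩ <;>
  obtain ⟨N, hN⟩ := hcauchy v hv
  · rw [← hu]
    refine le_seqLiminf (N + 1) fun n hn => ?_
    obtain ⟨n, rfl⟩ := Nat.exists_eq_succ_of_ne_zero (Nat.ne_zero_of_lt hn)
    rw [Nat.succ_eq_add_one, hs_succ]
    refine le_trans ?_ (hf' _ _)
    rw [← hu']
    exact le_seqLiminf N fun m hm => hN m hm n (Nat.le_of_succ_le_succ hn)
  · rw [← hu']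
    refine le_seqLiminf (N + 1) fun n hn => ?_
    obtain ⟨n, rfl⟩ := Nat.exists_eq_succ_of_ne_zero (Nat.ne_zero_of_lt hn)
    rw [Nat.succ_eq_add_one, hs_succ]
    refine le_trans ?_ (hf' _ _)
    rw [← hu]
    exact le_seqLiminf N fun m hm => hN n (Nat.le_of_succ_le_succ hn) m hm
end
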